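/- For every δ ∈ (0,1) there exists K_δ > 0 such that for every centered Gaussian process (X(t))_{t∈ℝ} with stationary increments, X(0) = 0, and continuous sample paths, and for all real numbers N ≤ 0 ≤ M and all ε > 0, one has: P(sup_{0≤t≤M+|N|} |X(t)| ≤ (1−δ)ε) · P(|X(N)| ≤ ε/K_δ) ≤ P(sup_{N≤t≤M} |X(t)| ≤ ε) ≤ P(sup_{0≤t≤M+|N|} |X(t)| ≤ (1+δ)ε) · P(|X(N)| ≤ ε/K_δ)^{−1}. -/

import Mathlib

open MeasureTheory ProbabilityTheory Filter Set
open scoped NNReal ENNReal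

noncomputable section

universe u

/-- A process indexed by `ℝ` is centered Gaussian if every finite linear combination of its
values is a centered one-dimensional Gaussian random variable. -/
def IsCenteredGaussianProcess {Ω : Type u} [MeasureSpace Ω] (X : ℝ → Ω → ℝ) : Prop :=
  ∀ (n : ℕ) (t : Fin n → ℝ) (a : Fin n → ℝ), ∃ v : ℝ≥0,
    Measure.map (fun ω => ∑ i, a i * X (t i) ω) ℙ = gaussianReal 0 v

/-- A process indexed by `ℝ` has stationary increments if for every `h` the process
`(X (t+h) - X h)_t` has the same finite-dimensional distributions as `(X t - X 0)_t`. -/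
def HasStationaryIncrements {Ω : Type u} [MeasureSpace Ω] (X : ℝ → Ω → ℝ) : Prop :=
  ∀ (h : ℝ) (n : ℕ) (t : Fin n → ℝ),
    Measure.map (fun ω => fun i => X (t i + h) ω - X h ω) ℙ =
    Measure.map (fun ω => fun i => X (t i) ω - X 0 ω) ℙ

/-- The Prékopa–Leindler inequality for the weights `1 / 2`, in multiplicative form. -/
def MidpointPrekopaLeindler {E : Type*} [AddCommGroup E] [Module ℝ E] [MeasurableSpace E]
    (μ : Measure E) : Prop :=
  ∀ f g h : E → ℝ≥0∞, Measurable f → Measurable g → Measurable h →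
    (∀ x y, f x * g y ≤ h (midpoint ℝ x y) ^ 2) →
    (∫⁻ x, f x ∂μ) * ∫⁻ x, g x ∂μ ≤ (∫⁻ x, h x ∂μ) ^ 2

theorem volume_add_le_of_isCompact {K L C : Set ℝ} (hK : IsCompact K) (hL : IsCompact L)
    (hK' : K.Nonempty) (hL' : L.Nonempty)
    (hC : ∀ x ∈ K, ∀ y ∈ L, midpoint ℝ x y ∈ C) :
    volume K + volume L ≤ 2 * volume C := by
  obtain ⟨a, haK, ha⟩ := hK.exists_isGreatest hK'
  obtain ⟨b, hbL, hb⟩ := hL.exists_isLeast hL'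
  let D : Set ℝ := (fun x => x * 2⁻¹) ⁻¹' C
  have hD : volume D = 2 * volume C := by
    rw [Real.volume_preimage_mul_right (by norm_num)]
    norm_num
  rw [← hD, ← measure_preimage_add_right volume (-b) K, ← measure_preimage_add_right volume (-a) L,
    ← measure_union₀]
  · refine measure_mono ?_
    rintro x (hx | hx)
    · have := hC _ hx _ hbL
      simpa [midpoint_eq_smul_add, D, mul_comm] using this
    · have := hC _ haK _ hx
      simpa [midpoint_eq_smul_add, D, mul_comm] using this
  · exact ((measurable_add_const _) hL.measurableSet).nullMeasurableSet
  · refine measure_mono_null (t := {a + b}) ?_ (by simp)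
    rintro x ⟨h1, h2⟩
    have := ha h1
    have := hb h2
    simp only [mem_singleton_iff]
    linarith

/-- The one-dimensional Brunn–Minkowski inequality for midpoints. -/
theorem volume_add_le_two_mul {A B C : Set ℝ} (hA : MeasurableSet A) (hB : MeasurableSet B)
    (hA' : A.Nonempty) (hB' : B.Nonempty)
    (hC : ∀ x ∈ A, ∀ y ∈ B, midpoint ℝ x y ∈ C) :
    volume A + volume B ≤ 2 * volume C := by
  obtain ⟨x₀, hx₀⟩ := hA'
  obtain ⟨y₀, hy₀⟩ := hB'
  rw [hA.measure_eq_iSup_isCompact, hB.measure_eq_iSup_isCompact]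
  simp_rw [iSup_and']
  refine ENNReal.biSup_add_biSup_le' ⟨∅, empty_subset _, isCompact_empty⟩
    ⟨∅, empty_subset _, isCompact_empty⟩ ?_
  rintro K ⟨hKA, hK⟩ L ⟨hLB, hL⟩
  calc volume K + volume L ≤ volume (insert x₀ K) + volume (insert y₀ L) := by
        gcongr <;> exact subset_insert _ _
    _ ≤ _ := volume_add_le_of_isCompact (hK.insert _) (hL.insert _) (by simp) (by simp)
        fun x hx y hy => hC x (insert_subset hx₀ hKA hx) y (insert_subset hy₀ hLB hy)

theorem ENNReal.mul_le_sq_of_add_le {a b c : ℝ≥0∞} (h : a + b ≤ 2 * c) : a * b ≤ c ^ 2 := by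
  rcases eq_or_ne c ⊤ with rfl | hc
  · simp
  have hab : a + b ≠ ⊤ := ne_top_of_le_ne_top (ENNReal.mul_ne_top (by simp) hc) h
  rw [ENNReal.add_ne_top] at hab
  lift a to ℝ≥0 using hab.1
  lift b to ℝ≥0 using hab.2
  lift c to ℝ≥0 using hc
  norm_cast at h ⊢
  rw [← NNReal.coe_le_coe] at h ⊢
  push_cast at h ⊢
  nlinarith [sq_nonneg ((a:ℝ) - b), a.2, b.2, c.2]

theorem lintegral_mul_le_sq_of_isLUB_one {f g h : ℝ → ℝ} (hf : Measurable f) (hg : Measurable g)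
    (hh : Measurable h) (hf0 : 0 ≤ f) (hg0 : 0 ≤ g) (hh0 : 0 ≤ h)
    (hf1 : IsLUB (range f) 1) (hg1 : IsLUB (range g) 1)
    (H : ∀ x y, f x * g y ≤ h (midpoint ℝ x y) ^ 2) :
    (∫⁻ x, ENNReal.ofReal (f x)) * (∫⁻ x, ENNReal.ofReal (g x)) ≤
      (∫⁻ x, ENNReal.ofReal (h x)) ^ 2 := by
  refine ENNReal.mul_le_sq_of_add_le ?_
  rw [lintegral_eq_lintegral_meas_lt _ (.of_forall hf0) hf.aemeasurable,
    lintegral_eq_lintegral_meas_lt _ (.of_forall hg0) hg.aemeasurable,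
    lintegral_eq_lintegral_meas_lt _ (.of_forall hh0) hh.aemeasurable,
    ← lintegral_const_mul' _ _ (by simp), ← lintegral_add_left' ?_]
  · refine setLIntegral_mono' measurableSet_Ioi fun s hs => ?_
    rcases lt_or_ge s 1 with hs1 | hs1
    · refine volume_add_le_two_mul (measurableSet_lt measurable_const hf)
        (measurableSet_lt measurable_const hg) ?_ ?_ ?_
      · obtain ⟨_, ⟨x, rfl⟩, hx, -⟩ := hf1.exists_between hs1
        exact ⟨x, hx⟩
      · obtain ⟨_, ⟨x, rfl⟩, hx, -⟩ := hg1.exists_between hs1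
        exact ⟨x, hx⟩
      · intro x hx y hy
        have hx' : s < f x := hx
        have hy' : s < g y := hy
        have hs0 : 0 < s := hs
        refine lt_of_pow_lt_pow_left₀ 2 (hh0 _) ((H x y).trans_lt' ?_)
        nlinarith
    · have e1 : {a | s < f a} = ∅ := by
        ext x; simpa using (hf1.1 ⟨x, rfl⟩).trans hs1
      have e2 : {a | s < g a} = ∅ := by
        ext x; simpa using (hg1.1 ⟨x, rfl⟩).trans hs1
      simp [e1, e2]
  · refine (Antitone.measurable fun s t hst => measure_mono fun x hx => ?_).aemeasurable
    exact lt_of_le_of_lt hst hx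

theorem lintegral_mul_le_sq_of_bddAbove {f g h : ℝ → ℝ} (hf : Measurable f) (hg : Measurable g)
    (hh : Measurable h) (hf0 : 0 ≤ f) (hg0 : 0 ≤ g) (hh0 : 0 ≤ h)
    (hf1 : BddAbove (range f)) (hg1 : BddAbove (range g))
    (H : ∀ x y, f x * g y ≤ h (midpoint ℝ x y) ^ 2) :
    (∫⁻ x, ENNReal.ofReal (f x)) * (∫⁻ x, ENNReal.ofReal (g x)) ≤
      (∫⁻ x, ENNReal.ofReal (h x)) ^ 2 := by
  by_cases hfz : ∀ x, f x = 0
  · simp [hfz]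
  by_cases hgz : ∀ x, g x = 0
  · simp [hgz]
  push Not at hfz hgz
  have key : ∀ {u : ℝ → ℝ}, 0 ≤ u → BddAbove (range u) → (∃ x, u x ≠ 0) →
      ∃ c : ℝ, 0 < c ∧ IsLUB (range fun x => c⁻¹ ^ 2 * u x) 1 := by
    rintro u hu0 hu1 ⟨x, hx⟩
    have hlub := isLUB_csSup (range_nonempty u) hu1
    have hpos : 0 < sSup (range u) :=
      ((hu0 x).lt_of_ne' hx).trans_le (hlub.1 ⟨x, rfl⟩)
    refine ⟨√(sSup (range u)), Real.sqrt_pos.2 hpos, ?_⟩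
    rw [inv_pow, Real.sq_sqrt hpos.le]
    have := hlub.mul_left (inv_nonneg.2 hpos.le)
    rwa [inv_mul_cancel₀ hpos.ne', ← range_comp] at this
  obtain ⟨c, hc, hcf⟩ := key hf0 hf1 hfz
  obtain ⟨d, hd, hdg⟩ := key hg0 hg1 hgz
  have := lintegral_mul_le_sq_of_isLUB_one (h := fun x => (c⁻¹ * d⁻¹) * h x)
    (hf.const_mul (c⁻¹ ^ 2)) (hg.const_mul (d⁻¹ ^ 2)) (hh.const_mul _)
    (fun x => mul_nonneg (by positivity) (hf0 x)) (fun x => mul_nonneg (by positivity) (hg0 x))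
    (fun x => mul_nonneg (by positivity) (hh0 x)) hcf hdg (fun x y => by
      calc _ = (c⁻¹ * d⁻¹) ^ 2 * (f x * g y) := by ring
        _ ≤ (c⁻¹ * d⁻¹) ^ 2 * h (midpoint ℝ x y) ^ 2 := by gcongr; exact H x y
        _ = _ := by ring)
  simp_rw [ENNReal.ofReal_mul (show 0 ≤ c⁻¹ ^ 2 by positivity),
    ENNReal.ofReal_mul (show 0 ≤ d⁻¹ ^ 2 by positivity),
    ENNReal.ofReal_mul (show 0 ≤ c⁻¹ * d⁻¹ by positivity)] at this
  rw [lintegral_const_mul' _ _ (by simp), lintegral_const_mul' _ _ (by simp),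
    lintegral_const_mul' _ _ (by simp), mul_pow, mul_mul_mul_comm,
    ← ENNReal.ofReal_mul (by positivity), ← ENNReal.ofReal_pow (by positivity), ← mul_pow,
    ENNReal.mul_le_mul_iff_right (ENNReal.ofReal_pos.2 (by positivity)).ne' (by simp)] at this
  exact this

theorem midpointPrekopaLeindler_volume : MidpointPrekopaLeindler (volume : Measure ℝ) := by
  intro f g h hf hg hh H
  have trunc : ∀ {u : ℝ → ℝ≥0∞}, Measurable u →
      ∫⁻ x, u x = ⨆ n : ℕ, ∫⁻ x, min (u x) n := by
    intro u hu
    rw [← lintegral_iSup (fun n => hu.min measurable_const)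
      (fun m n hmn x => min_le_min_left _ (by exact_mod_cast hmn))]
    refine lintegral_congr fun x => ?_
    change _ = ⨆ n : ℕ, u x ⊓ n
    rw [← inf_iSup_eq, ENNReal.iSup_natCast, inf_top_eq]
  have hreal : ∀ (u : ℝ → ℝ≥0∞) (n : ℕ) x, ENNReal.ofReal (min (u x) n).toReal = min (u x) n :=
    fun u n x => ENNReal.ofReal_toReal (by simp)
  have hmono : ∀ u : ℝ → ℝ≥0∞, Monotone fun n : ℕ => ∫⁻ x, min (u x) n :=
    fun u m n hmn => lintegral_mono fun x => min_le_min_left _ (by exact_mod_cast hmn)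
  rw [trunc hf, trunc hg, ENNReal.iSup_mul]
  refine iSup_le fun m => ?_
  rw [ENNReal.mul_iSup]
  refine iSup_le fun k => (mul_le_mul' (hmono f (le_max_left m k))
    (hmono g (le_max_right m k))).trans ?_
  generalize max m k = n
  refine le_trans ?_ (pow_le_pow_left' (lintegral_mono fun x => min_le_left (h x) n) 2)
  have hb : ∀ u : ℝ → ℝ≥0∞, BddAbove (range fun x => (min (u x) n).toReal) := by
    refine fun u => ⟨n, ?_⟩
    rintro _ ⟨x, rfl⟩
    exact ENNReal.toReal_le_of_le_ofReal (by simp) (by simp)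
  have := lintegral_mul_le_sq_of_bddAbove
    (f := fun x => (min (f x) n).toReal) (g := fun x => (min (g x) n).toReal)
    (h := fun x => (min (h x) n).toReal)
    (hf.min measurable_const).ennreal_toReal (hg.min measurable_const).ennreal_toReal
    (hh.min measurable_const).ennreal_toReal
    (fun _ => ENNReal.toReal_nonneg) (fun _ => ENNReal.toReal_nonneg)
    (fun _ => ENNReal.toReal_nonneg) (hb f) (hb g) (fun x y => by
      rw [← ENNReal.toReal_mul, ← ENNReal.toReal_pow]
      refine ENNReal.toReal_mono (by simp) ?_
      rcases le_total (h (midpoint ℝ x y)) n with hn | hn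
      · rw [min_eq_left hn]
        exact (mul_le_mul' (min_le_left _ _) (min_le_left _ _)).trans (H x y)
      · rw [min_eq_right hn, sq]
        exact mul_le_mul' (min_le_right _ _) (min_le_right _ _))
  simpa only [hreal] using this

namespace MidpointPrekopaLeindler

variable {E F : Type*} [AddCommGroup E] [Module ℝ E] [MeasurableSpace E]
  [AddCommGroup F] [Module ℝ F] [MeasurableSpace F] {μ : Measure E} {ν : Measure F}

theorem map (hμ : MidpointPrekopaLeindler μ) {L : E → F} (hL : Measurable L)
    (hmid : ∀ x y, L (midpoint ℝ x y) = midpoint ℝ (L x) (L y)) :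
    MidpointPrekopaLeindler (μ.map L) := by
  intro f g h hf hg hh H
  rw [lintegral_map hf hL, lintegral_map hg hL, lintegral_map hh hL]
  exact hμ _ _ _ (hf.comp hL) (hg.comp hL) (hh.comp hL) fun x y => by
    simpa only [Function.comp_apply, hmid] using H (L x) (L y)

theorem prod [SFinite ν] (hμ : MidpointPrekopaLeindler μ) (hν : MidpointPrekopaLeindler ν) :
    MidpointPrekopaLeindler (μ.prod ν) := by
  intro f g h hf hg hh H
  rw [lintegral_prod _ hf.aemeasurable, lintegral_prod _ hg.aemeasurable,
    lintegral_prod _ hh.aemeasurable]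
  refine hμ _ _ _ hf.lintegral_prod_right' hg.lintegral_prod_right' hh.lintegral_prod_right'
    fun x x' => ?_
  exact hν _ _ _ (hf.comp measurable_prodMk_left) (hg.comp measurable_prodMk_left)
    (hh.comp measurable_prodMk_left) fun y y' => by
      simpa [midpoint, AffineMap.lineMap_apply] using H (x, y) (x', y')

theorem withDensity (hμ : MidpointPrekopaLeindler μ) {p : E → ℝ≥0∞} (hp : Measurable p)
    (hmid : ∀ x y, p x * p y ≤ p (midpoint ℝ x y) ^ 2) :
    MidpointPrekopaLeindler (μ.withDensity p) := by
  intro f g h hf hg hh H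
  rw [lintegral_withDensity_eq_lintegral_mul _ hp hf, lintegral_withDensity_eq_lintegral_mul _ hp hg,
    lintegral_withDensity_eq_lintegral_mul _ hp hh]
  refine hμ _ _ _ (hp.mul hf) (hp.mul hg) (hp.mul hh) fun x y => ?_
  simp only [Pi.mul_apply]
  rw [mul_mul_mul_comm, mul_pow]
  exact mul_le_mul' (hmid x y) (H x y)

end MidpointPrekopaLeindler

theorem midpointPrekopaLeindler_gaussianReal :
    MidpointPrekopaLeindler (gaussianReal 0 1) := by
  rw [gaussianReal_of_var_ne_zero _ one_ne_zero]
  refine midpointPrekopaLeindler_volume.withDensity (measurable_gaussianPDF _ _) fun x y => ?_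
  simp only [gaussianPDF]
  rw [← ENNReal.ofReal_mul (gaussianPDFReal_nonneg _ _ _),
    ← ENNReal.ofReal_pow (gaussianPDFReal_nonneg _ _ _)]
  refine ENNReal.ofReal_le_ofReal ?_
  simp only [gaussianPDFReal]
  rw [mul_mul_mul_comm, mul_pow, sq (√_)⁻¹, ← Real.exp_add, sq (Real.exp _), ← Real.exp_add]
  refine mul_le_mul_of_nonneg_left (Real.exp_le_exp.2 ?_) (by positivity)
  simp only [midpoint_eq_smul_add, smul_eq_mul, invOf_eq_inv, NNReal.coe_one]
  nlinarith [sq_nonneg (x - y)]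

theorem midpointPrekopaLeindler_pi_gaussianReal (n : ℕ) :
    MidpointPrekopaLeindler (Measure.pi fun _ : Fin n => gaussianReal 0 1) := by
  induction n with
  | zero =>
    intro f g h hf hg hh H
    rw [Measure.pi_of_empty _ 0]
    simpa [lintegral_dirac] using H 0 0
  | succ n ih =>
    have e := (measurePreserving_piFinSuccAbove (fun _ : Fin (n + 1) => gaussianReal 0 1) 0).symm
    rw [← e.map_eq]
    refine (midpointPrekopaLeindler_gaussianReal.prod ih).map e.measurable fun x y => ?_
    ext i
    refine Fin.cases ?_ (fun j => ?_) i <;>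
      simp [midpoint, AffineMap.lineMap_apply, MeasurableEquiv.piFinSuccAbove]

theorem midpointPrekopaLeindler_of_isGaussian {n : ℕ} (μ : Measure (EuclideanSpace ℝ (Fin n)))
    [IsGaussian μ] (hμ : ∫ x, x ∂μ = 0) : MidpointPrekopaLeindler μ := by
  let b := (EuclideanSpace.basisFun (Fin n) ℝ).toBasis
  let S : Matrix (Fin n) (Fin n) ℝ := LinearMap.toMatrix₂ b b (covarianceBilin μ).toBilinForm
  have hS : S.PosSemidef := by
    have := isPosSemidef_covarianceBilin (μ := μ)
    exact (LinearMap.isPosSemidef_iff_posSemidef_toMatrix b).1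
      ⟨⟨this.isSymm.eq⟩, ⟨this.isNonneg.nonneg⟩⟩
  have hμS : μ = multivariateGaussian 0 S := by
    refine IsGaussian.ext ?_ ?_
    · simp [hμ]
    · ext x y
      rw [covarianceBilin_multivariateGaussian hS]
      exact apply_eq_dotProduct_toMatrix₂_mulVec b b (covarianceBilin μ).toBilinForm x y
  rw [hμS, multivariateGaussian, stdGaussian]
  refine ((midpointPrekopaLeindler_pi_gaussianReal _).map ?_ fun x y => ?_).map ?_ fun x y => ?_
  · fun_prop
  · simp [midpoint_eq_smul_add, Finset.sum_add_distrib, add_smul, mul_smul, Finset.smul_sum]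
  · fun_prop
  · simp [midpoint_eq_smul_add]

/-- A weak form of the Gaussian correlation inequality for symmetric convex sets. -/
theorem measure_mul_le_measure_inter {E : Type*} [NormedAddCommGroup E] [NormedSpace ℝ E]
    [MeasurableSpace E] [BorelSpace E] [SecondCountableTopology E]
    {μ : Measure E} [IsProbabilityMeasure μ]
    (hμ : MidpointPrekopaLeindler μ)
    (hrot : ∀ θ : ℝ, (μ.prod μ).map (ContinuousLinearMap.rotation θ) = μ.prod μ)
    {A B : Set E} (hA : MeasurableSet A) (hB : MeasurableSet B)
    (hAc : Convex ℝ A) (hBc : Convex ℝ B) (hBs : ∀ x ∈ B, -x ∈ B) (hAs : ∀ x ∈ A, -x ∈ A)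
    {θ : ℝ} (hc : Real.cos θ ≠ 0) (hs : Real.sin θ ≠ 0) :
    μ {x | (Real.cos θ)⁻¹ • x ∈ A} * μ {x | (Real.sin θ)⁻¹ • x ∈ B} ≤ μ (A ∩ B) := by
  set c := Real.cos θ
  set s := Real.sin θ
  have hneg : μ.map (fun x => -x) = μ := by
    have h := congrArg (fun m => m.map Prod.fst) (hrot Real.pi)
    beta_reduce at h
    rw [Measure.map_map (by fun_prop) (by fun_prop), Measure.map_fst_prod] at h
    have e : (Prod.fst ∘ (ContinuousLinearMap.rotation Real.pi : E × E →L[ℝ] E × E))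
        = (fun x => -x) ∘ Prod.fst := by
      ext x; simp [ContinuousLinearMap.rotation]
    rw [e, ← Measure.map_map (by fun_prop) (by fun_prop), Measure.map_fst_prod] at h
    simpa using h
  let D : E → Set E := fun v => {u | u + (s / c) • v ∈ A ∧ -u + (c / s) • v ∈ B}
  have hDm : ∀ v, MeasurableSet (D v) := fun v =>
    (hA.preimage (by fun_prop)).inter (hB.preimage (by fun_prop))
  have hD : ∀ v, μ (D v) ≤ μ (A ∩ B) := by
    intro v
    have h1 : μ (D (-v)) = μ (D v) := by
      conv_lhs => rw [← hneg]
      rw [Measure.map_apply (by fun_prop) (hDm _)]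
      congr 1
      ext u
      simp only [D, mem_preimage, mem_ofPred_eq, smul_neg, neg_neg]
      refine and_congr ⟨fun h => ?_, fun h => ?_⟩ ⟨fun h => ?_, fun h => ?_⟩
      · simpa [add_comm] using hAs _ h
      · simpa [add_comm] using hAs _ h
      · simpa [add_comm] using hBs _ h
      · simpa [add_comm] using hBs _ h
    have := hμ ((D v).indicator 1) ((D (-v)).indicator 1) ((A ∩ B).indicator 1)
      (measurable_one.indicator (hDm v)) (measurable_one.indicator (hDm _))
      (measurable_one.indicator (hA.inter hB)) (fun x y => by
        by_cases hx : x ∈ D v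
        swap; · simp [hx]
        by_cases hy : y ∈ D (-v)
        swap; · simp [hy]
        have : midpoint ℝ x y ∈ A ∩ B := by
          have h1 := hAc.midpoint_mem hx.1 hy.1
          have h2 := hBs _ (hBc.midpoint_mem hx.2 hy.2)
          refine ⟨?_, ?_⟩
          · convert h1 using 1
            simp only [midpoint_eq_smul_add]; module
          · convert h2 using 1
            simp only [midpoint_eq_smul_add]; module
        simp [hx, hy, this])
    rw [lintegral_indicator_one (hDm _), lintegral_indicator_one (hDm _),
      lintegral_indicator_one (hA.inter hB), h1, ← sq] at this
    exact (ENNReal.pow_le_pow_left_iff two_ne_zero).1 this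
  have hPm : MeasurableSet {x | c⁻¹ • x ∈ A} := hA.preimage (by fun_prop)
  have hQm : MeasurableSet {x | s⁻¹ • x ∈ B} := hB.preimage (by fun_prop)
  rw [← Measure.prod_prod, ← hrot θ, Measure.map_apply (by fun_prop) (hPm.prod hQm),
    Measure.prod_apply_symm ((hPm.prod hQm).preimage (by fun_prop))]
  calc _ ≤ ∫⁻ _, μ (A ∩ B) ∂μ := by
        refine lintegral_mono fun v => (measure_mono ?_).trans (hD v)
        rintro u ⟨h1, h2⟩
        simp only [ContinuousLinearMap.rotation_apply, mem_ofPred_eq] at h1 h2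
        refine ⟨?_, ?_⟩
        · convert h1 using 1
          rw [smul_add, smul_smul, smul_smul, inv_mul_cancel₀ hc]
          module
        · convert h2 using 1
          rw [smul_add, smul_smul, smul_smul, mul_neg, inv_mul_cancel₀ hs]
          module
    _ = μ (A ∩ B) := by simp

section Gaussian

variable {Ω : Type*} [MeasureSpace Ω] {X : ℝ → Ω → ℝ}

theorem IsCenteredGaussianProcess.aemeasurable (hX : IsCenteredGaussianProcess X) (t : ℝ) :
    AEMeasurable (X t) ℙ := by
  obtain ⟨v, hv⟩ := hX 1 (fun _ => t) (fun _ => 1)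
  have : (fun ω => ∑ i : Fin 1, (fun _ => (1 : ℝ)) i * X ((fun _ => t) i) ω) = X t := by
    ext ω; simp
  rw [this] at hv
  exact AEMeasurable.of_map_ne_zero (by rw [hv]; exact NeZero.ne _)

theorem IsCenteredGaussianProcess.measure_abs_le_ne_zero (hX : IsCenteredGaussianProcess X) (t : ℝ)
    {r : ℝ} (hr : 0 < r) : ℙ {ω | |X t ω| ≤ r} ≠ 0 := by
  obtain ⟨v, hv⟩ := hX 1 (fun _ => t) (fun _ => 1)
  have : (fun ω => ∑ i : Fin 1, (fun _ => (1 : ℝ)) i * X ((fun _ => t) i) ω) = X t := by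
    ext ω; simp
  rw [this] at hv
  have hm : MeasurableSet {x : ℝ | |x| ≤ r} := measurableSet_le (by fun_prop) (by fun_prop)
  have e : ℙ {ω | |X t ω| ≤ r} = gaussianReal 0 v {x | |x| ≤ r} := by
    rw [← hv, Measure.map_apply_of_aemeasurable (hX.aemeasurable t) hm]; rfl
  rw [e]
  by_cases h0 : v = 0
  · simp [h0, hm, hr.le]
  · intro h
    have h2 := gaussianReal_absolutelyContinuous' 0 h0 h
    have h3 : Icc (-r) r ⊆ {x | |x| ≤ r} := fun x hx => abs_le.2 hx
    have h4 := measure_mono_null h3 h2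
    rw [Real.volume_Icc, ENNReal.ofReal_eq_zero] at h4
    linarith

theorem IsCenteredGaussianProcess.isGaussian_map (hX : IsCenteredGaussianProcess X) {n : ℕ}
    (t : Fin n → ℝ) :
    ∃ _ : IsGaussian ((ℙ : Measure Ω).map fun ω => WithLp.toLp 2 fun i => X (t i) ω),
      ∀ L : StrongDual ℝ (EuclideanSpace ℝ (Fin n)),
        ∫ x, L x ∂((ℙ : Measure Ω).map fun ω => WithLp.toLp 2 fun i => X (t i) ω) = 0 := by
  have hm : AEMeasurable (fun ω => WithLp.toLp 2 fun i => X (t i) ω) (ℙ : Measure Ω) :=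
    (WithLp.measurable_toLp 2 _).comp_aemeasurable
      (aemeasurable_pi_lambda _ fun i => hX.aemeasurable (t i))
  have key : ∀ L : StrongDual ℝ (EuclideanSpace ℝ (Fin n)), ∃ v : ℝ≥0,
      ((ℙ : Measure Ω).map fun ω => WithLp.toLp 2 fun i => X (t i) ω).map L
        = gaussianReal 0 v := by
    intro L
    obtain ⟨v, hv⟩ := hX n t fun i => L (EuclideanSpace.basisFun (Fin n) ℝ i)
    refine ⟨v, ?_⟩
    rw [AEMeasurable.map_map_of_aemeasurable (by fun_prop) hm, ← hv]
    congr 1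
    ext ω
    have := (EuclideanSpace.basisFun (Fin n) ℝ).sum_repr (WithLp.toLp 2 fun i => X (t i) ω)
    rw [Function.comp_apply, ← this]
    simp [mul_comm]
  refine ⟨isGaussian_of_map_eq_gaussianReal fun L => ⟨0, key L⟩, fun L => ?_⟩
  obtain ⟨v, hv⟩ := key L
  have : ∫ x, x ∂(gaussianReal 0 v) = 0 := integral_id_gaussianReal
  rw [← hv, integral_map (by fun_prop) (by fun_prop)] at this
  exact this

theorem IsCenteredGaussianProcess.measure_mul_le_fin [IsProbabilityMeasure (ℙ : Measure Ω)]
    (hX : IsCenteredGaussianProcess X) {n : ℕ} (t : Fin n → ℝ) (s c a b : ℝ) {θ : ℝ}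
    (hcos : 0 < Real.cos θ) (hsin : 0 < Real.sin θ) :
    ℙ {ω | ∀ i, |X (t i) ω - c * X s ω| ≤ Real.cos θ * a} *
        ℙ {ω | |X s ω| ≤ Real.sin θ * b} ≤
      ℙ {ω | (∀ i, |X (t i) ω - c * X s ω| ≤ a) ∧ |X s ω| ≤ b} := by
  let r : Fin (n + 1) → ℝ := Fin.cons s t
  let T : Ω → EuclideanSpace ℝ (Fin (n + 1)) := fun ω => WithLp.toLp 2 fun i => X (r i) ω
  have hT : AEMeasurable T ℙ := (WithLp.measurable_toLp 2 _).comp_aemeasurable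
    (aemeasurable_pi_lambda _ fun i => hX.aemeasurable (r i))
  obtain ⟨hG, hL⟩ := hX.isGaussian_map r
  set μ : Measure (EuclideanSpace ℝ (Fin (n + 1))) := (ℙ : Measure Ω).map T
  have hμ0 : ∫ x, x ∂μ = 0 := by
    refine SeparatingDual.eq_zero_of_forall_dual_eq_zero (R := ℝ) fun L => ?_
    rw [← L.integral_comp_comm IsGaussian.integrable_fun_id]
    exact hL L
  let A : ℝ → Set (EuclideanSpace ℝ (Fin (n + 1))) :=
    fun a => ⋂ i : Fin n, {y | |y i.succ - c * y 0| ≤ a}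
  let B : ℝ → Set (EuclideanSpace ℝ (Fin (n + 1))) := fun b => {y | |y 0| ≤ b}
  have hA : ∀ a, MeasurableSet (A a) := fun a =>
    .iInter fun i => measurableSet_le (by fun_prop) (by fun_prop)
  have hB : ∀ b, MeasurableSet (B b) := fun b => measurableSet_le (by fun_prop) (by fun_prop)
  have hconv : ∀ (L : EuclideanSpace ℝ (Fin (n + 1)) →ₗ[ℝ] ℝ) (a : ℝ),
      Convex ℝ {y | |L y| ≤ a} := by
    intro L a
    have : {y | |L y| ≤ a} = L ⁻¹' Icc (-a) a := by ext; simp [abs_le]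
    rw [this]
    exact (convex_Icc _ _).linear_preimage L
  let p : Fin (n + 1) → EuclideanSpace ℝ (Fin (n + 1)) →ₗ[ℝ] ℝ := fun i =>
    (EuclideanSpace.proj (𝕜 := ℝ) i).toLinearMap
  have main := measure_mul_le_measure_inter (midpointPrekopaLeindler_of_isGaussian μ hμ0)
    (IsGaussian.map_rotation_eq_self_of_forall_strongDual_eq_zero hL) (hA a) (hB b)
    (convex_iInter fun i => hconv (p i.succ - c • p 0) a) (hconv (p 0) b)
    (fun x hx => by simpa [B] using hx)
    (fun x hx => by
      simp only [A, mem_iInter, mem_ofPred_eq] at hx ⊢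
      intro i
      rw [← abs_neg]
      convert hx i using 2
      simp; ring) hcos.ne' hsin.ne'
  have hA' : {x | (Real.cos θ)⁻¹ • x ∈ A a} = A (Real.cos θ * a) := by
    ext x
    simp only [A, mem_iInter, mem_ofPred_eq, PiLp.smul_apply, smul_eq_mul]
    refine forall_congr' fun i => ?_
    rw [mul_left_comm, ← mul_sub, abs_mul, abs_of_pos (inv_pos.2 hcos), inv_mul_le_iff₀ hcos]
  have hB' : {x | (Real.sin θ)⁻¹ • x ∈ B b} = B (Real.sin θ * b) := by
    ext x
    simp only [B, mem_ofPred_eq, PiLp.smul_apply, smul_eq_mul]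
    rw [abs_mul, abs_of_pos (inv_pos.2 hsin), inv_mul_le_iff₀ hsin]
  rw [hA', hB', Measure.map_apply_of_aemeasurable hT (hA _),
    Measure.map_apply_of_aemeasurable hT (hB _),
    Measure.map_apply_of_aemeasurable hT ((hA _).inter (hB _))] at main
  have e1 : ∀ a, T ⁻¹' A a = {ω | ∀ i, |X (t i) ω - c * X s ω| ≤ a} := fun a => by
    ext ω; simp [A, T, r]
  have e2 : ∀ b, T ⁻¹' B b = {ω | |X s ω| ≤ b} := fun b => by
    ext ω; simp [B, T, r]
  rw [preimage_inter, e1, e1, e2, e2] at main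
  exact main

theorem tendsto_measure_forall_fin_abs_le [IsFiniteMeasure (ℙ : Measure Ω)] {Y : ℕ → Ω → ℝ}
    (hY : ∀ i, AEMeasurable (Y i) ℙ) (a : ℝ) :
    Tendsto (fun n : ℕ => ℙ {ω | ∀ i : Fin n, |Y i ω| ≤ a}) atTop
      (nhds (ℙ {ω | ∀ i, |Y i ω| ≤ a})) := by
  have e : {ω | ∀ i, |Y i ω| ≤ a} = ⋂ n : ℕ, {ω | ∀ i : Fin n, |Y i ω| ≤ a} := by
    ext ω
    simp only [mem_ofPred_eq, mem_iInter]
    exact ⟨fun h n i => h i, fun h i => h (i + 1) (Fin.last i)⟩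
  rw [e]
  refine tendsto_measure_iInter_atTop (fun n => ?_) (fun m n hmn ω h i => ?_) ⟨0, by finiteness⟩
  · rw [ofPred_forall]
    exact .iInter fun i => nullMeasurableSet_le (hY i).abs aemeasurable_const
  · exact h (Fin.castLE hmn i)

theorem IsCenteredGaussianProcess.measure_mul_le [IsProbabilityMeasure (ℙ : Measure Ω)]
    (hX : IsCenteredGaussianProcess X) (t : ℕ → ℝ) (s : ℝ) {a b c c' : ℝ} {θ : ℝ}
    (hcos : 0 < Real.cos θ) (hsin : 0 < Real.sin θ) (hc : |c - c'| ≤ 1) :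
    ℙ {ω | ∀ i, |X (t i) ω - c * X s ω| ≤ Real.cos θ * a} *
        ℙ {ω | |X s ω| ≤ Real.sin θ * b} ≤
      ℙ {ω | ∀ i, |X (t i) ω - c' * X s ω| ≤ a + b} := by
  refine ge_of_tendsto' (tendsto_measure_forall_fin_abs_le
    (fun i => (hX.aemeasurable (t i)).sub ((hX.aemeasurable s).const_mul c')) _) fun n => ?_
  calc _ ≤ ℙ {ω | ∀ i : Fin n, |X (t i) ω - c * X s ω| ≤ Real.cos θ * a} *
        ℙ {ω | |X s ω| ≤ Real.sin θ * b} := by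
        gcongr with ω; exact fun h i => h i
    _ ≤ _ := hX.measure_mul_le_fin (fun i : Fin n => t i) s c a b hcos hsin
    _ ≤ _ := by
        refine measure_mono fun ω h i => ?_
        have h1 := h.1 i
        have h2 := h.2
        calc |X (t i) ω - c' * X s ω| = |(X (t i) ω - c * X s ω) + (c - c') * X s ω| := by
              congr 1; ring
          _ ≤ |X (t i) ω - c * X s ω| + |c - c'| * |X s ω| := by
              rw [← abs_mul]; exact abs_add_le _ _
          _ ≤ a + 1 * b := by gcongr
          _ = a + b := by ring

theorem HasStationaryIncrements.measure_abs_sub_le [IsProbabilityMeasure (ℙ : Measure Ω)]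
    (hS : HasStationaryIncrements X) (hm : ∀ t, AEMeasurable (X t) ℙ) (h0 : ∀ ω, X 0 ω = 0)
    (t : ℕ → ℝ) (h a : ℝ) :
    ℙ {ω | ∀ i, |X (t i + h) ω - X h ω| ≤ a} = ℙ {ω | ∀ i, |X (t i) ω| ≤ a} := by
  refine tendsto_nhds_unique (tendsto_measure_forall_fin_abs_le
    (fun i => (hm (t i + h)).sub (hm h)) a) ((tendsto_congr fun n => ?_).2
      (tendsto_measure_forall_fin_abs_le (fun i => hm (t i)) a))
  have hD : MeasurableSet {y : Fin n → ℝ | ∀ i, |y i| ≤ a} := by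
    rw [ofPred_forall]
    exact .iInter fun i => measurableSet_le (by fun_prop) (by fun_prop)
  have := congrArg (fun m => m {y : Fin n → ℝ | ∀ i, |y i| ≤ a}) (hS h n fun i => t i)
  beta_reduce at this
  have h1 : AEMeasurable (fun ω (i : Fin n) => X (t i + h) ω - X h ω) ℙ :=
    aemeasurable_pi_lambda _ fun i => (hm _).sub (hm h)
  have h2 : AEMeasurable (fun ω (i : Fin n) => X (t i) ω - X 0 ω) ℙ :=
    aemeasurable_pi_lambda _ fun i => (hm _).sub (hm 0)
  rw [Measure.map_apply_of_aemeasurable h1 hD, Measure.map_apply_of_aemeasurable h2 hD] at this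
  simpa [h0] using this

end Gaussian

theorem iSup_abs_le_iff_denseSeq {f : ℝ → ℝ} (hf : Continuous f) {T : ℝ}
    [Nonempty (Icc (0 : ℝ) T)] (N : ℝ) {c : ℝ} (hc : 0 ≤ c) :
    (⨆ u ∈ Icc N (T + N), |f u|) ≤ c ↔
      ∀ i, |f (TopologicalSpace.denseSeq (Icc (0 : ℝ) T) i + N)| ≤ c := by
  constructor
  · intro h i
    obtain ⟨C, hC⟩ := (isCompact_Icc (a := N) (b := T + N)).bddAbove_image hf.abs.continuousOn
    have hb : BddAbove (range fun u => ⨆ _ : u ∈ Icc N (T + N), |f u|) := by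
      refine ⟨max C 0, ?_⟩
      rintro _ ⟨u, rfl⟩
      exact Real.iSup_le (fun hu => (hC ⟨u, hu, rfl⟩).trans (le_max_left _ _)) (le_max_right _ _)
    have hi := (TopologicalSpace.denseSeq (Icc (0 : ℝ) T) i).2
    set u := (TopologicalSpace.denseSeq (Icc (0 : ℝ) T) i : ℝ) + N with hu
    have hmem : u ∈ Icc N (T + N) := ⟨by linarith [hi.1], by linarith [hi.2]⟩
    have := le_ciSup hb u
    beta_reduce at this
    rw [ciSup_pos hmem] at this
    exact this.trans h
  · intro h
    refine Real.iSup_le (fun u => Real.iSup_le (fun hu => ?_) hc) hc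
    have hcl : IsClosed {x : Icc (0 : ℝ) T | |f (x + N)| ≤ c} :=
      isClosed_le (by fun_prop) (by fun_prop)
    have hall : ∀ x : Icc (0 : ℝ) T, |f (x + N)| ≤ c := fun x =>
      (TopologicalSpace.denseRange_denseSeq (Icc (0 : ℝ) T)).induction_on
        (p := fun x => |f (x + N)| ≤ c) x hcl h
    have := hall ⟨u - N, by linarith [hu.1], by linarith [hu.2]⟩
    simpa using this

theorem statement11 :
    ∀ δ : ℝ, δ ∈ Set.Ioo (0:ℝ) 1 → ∃ K : ℝ, 0 < K ∧
      ∀ (Ω : Type u) [MeasureSpace Ω] [IsProbabilityMeasure (ℙ : Measure Ω)]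
        (X : ℝ → Ω → ℝ),
        IsCenteredGaussianProcess X →
        HasStationaryIncrements X →
        (∀ ω, X 0 ω = 0) →
        (∀ ω, Continuous fun t => X t ω) →
        ∀ (N M ε : ℝ), N ≤ 0 → 0 ≤ M → 0 < ε →
          (ℙ {ω | ⨆ t ∈ Set.Icc (0:ℝ) (M + |N|), |X t ω| ≤ (1 - δ) * ε} *
              ℙ {ω | |X N ω| ≤ ε / K}
            ≤ ℙ {ω | ⨆ t ∈ Set.Icc N M, |X t ω| ≤ ε}) ∧
          (ℙ {ω | ⨆ t ∈ Set.Icc N M, |X t ω| ≤ ε}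
            ≤ ℙ {ω | ⨆ t ∈ Set.Icc (0:ℝ) (M + |N|), |X t ω| ≤ (1 + δ) * ε} *
              (ℙ {ω | |X N ω| ≤ ε / K})⁻¹) := by
  rintro δ ⟨hδ0, hδ1⟩
  let θ := Real.arccos (2 / (2 + δ))
  have hlt : 2 / (2 + δ) < 1 := by rw [div_lt_one (by linarith)]; linarith
  have hpos : 0 < 2 / (2 + δ) := by positivity
  have hcos : Real.cos θ = 2 / (2 + δ) := Real.cos_arccos (by linarith) hlt.le
  have hsin : 0 < Real.sin θ := by
    rw [Real.sin_arccos]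
    exact Real.sqrt_pos.2 (by nlinarith)
  have hcos0 : 0 < Real.cos θ := hcos ▸ hpos
  refine ⟨2 / (δ * Real.sin θ), by positivity, ?_⟩
  intro Ω _ _ X hX hS h0 hcont N M ε hN hM hε
  have hK : ε / (2 / (δ * Real.sin θ)) = Real.sin θ * (δ / 2 * ε) := by
    field_simp
  rw [hK]
  set T := M + |N|
  have hT : 0 ≤ T := by positivity
  have hTM : T + N = M := by simp [T, abs_of_nonpos hN]
  have : Nonempty (Icc (0 : ℝ) T) := ⟨⟨0, le_rfl, hT⟩⟩
  let t : ℕ → ℝ := fun i => TopologicalSpace.denseSeq (Icc (0 : ℝ) T) i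
  have hm := hX.aemeasurable
  have e0 : ∀ c, 0 ≤ c → ℙ {ω | ⨆ t ∈ Set.Icc (0:ℝ) T, |X t ω| ≤ c} =
      ℙ {ω | ∀ i, |X (t i + N) ω - 1 * X N ω| ≤ c} := by
    intro c hc
    simp_rw [one_mul]
    rw [hS.measure_abs_sub_le hm h0 t N c]
    congr 1
    ext ω
    simpa using iSup_abs_le_iff_denseSeq (hcont ω) (T := T) 0 hc
  have eN : ℙ {ω | ⨆ t ∈ Set.Icc N M, |X t ω| ≤ ε} =
      ℙ {ω | ∀ i, |X (t i + N) ω - 0 * X N ω| ≤ ε} := by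
    congr 1
    ext ω
    simpa [hTM] using iSup_abs_le_iff_denseSeq (hcont ω) (T := T) N hε.le
  rw [e0 _ (by nlinarith), e0 _ (by nlinarith), eN]
  constructor
  · refine le_trans ?_ ((hX.measure_mul_le (fun i => t i + N) N (c := 1) (c' := 0)
      (a := (1 - δ / 2) * ε) (b := δ / 2 * ε) hcos0 hsin (by simp)).trans_eq ?_)
    · refine mul_le_mul' (measure_mono fun ω h i => (h i).trans ?_) le_rfl
      rw [hcos, ← mul_assoc]
      gcongr
      rw [div_mul_eq_mul_div, le_div_iff₀ (by linarith)]
      nlinarith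
    · congr! 5
      ring
  · rw [← div_eq_mul_inv, ENNReal.le_div_iff_mul_le
      (.inl (hX.measure_abs_le_ne_zero N (by positivity))) (.inl (by finiteness))]
    refine le_trans (le_of_eq ?_) ((hX.measure_mul_le (fun i => t i + N) N (c := 0) (c' := 1)
      (a := (1 + δ / 2) * ε) (b := δ / 2 * ε) hcos0 hsin (by simp)).trans_eq ?_)
    · congr! 6
      rw [hcos]
      field_simp
    · congr! 5
      ring
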